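/- For every module M ∈ 𝓜_𝔩(𝔥)^×, the natural map α : U(𝔥) ⊗_{U(𝔭)} M^𝔩 → M, defined by α(u ⊗ m) = u·m (where the 𝔭-module structure on M^𝔩 has 𝔩 acting by zero and 𝔷 acting via the module structure), is an isomorphism of 𝔥-modules. -/

import Mathlib

open scoped TensorProduct

structure AltBilin (k V : Type*) [Field k] [AddCommGroup V] [Module k V] where
  form : V →ₗ[k] V →ₗ[k] k
  alt : ∀ v : V, form v v = 0

variable {k V : Type*} [Field k] [AddCommGroup V] [Module k V]

def Heisenberg (ω : AltBilin k V) : Type _ := V × k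

namespace Heisenberg
variable (ω : AltBilin k V)
instance : AddCommGroup (Heisenberg ω) := inferInstanceAs (AddCommGroup (V × k))
instance : Module k (Heisenberg ω) := inferInstanceAs (Module k (V × k))
instance : LieRing (Heisenberg ω) where
  bracket x y := (((0 : V), ω.form x.1 y.1) : V × k)
  add_lie x y z := by
    show (((0 : V), ω.form (x.1 + y.1) z.1) : V × k)
      = ((0 : V), ω.form x.1 z.1) + ((0 : V), ω.form y.1 z.1)
    ext <;> simp
  lie_add x y z := by
    show (((0 : V), ω.form x.1 (y.1 + z.1)) : V × k)
      = ((0 : V), ω.form x.1 y.1) + ((0 : V), ω.form x.1 z.1)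
    ext <;> simp
  lie_self x := by
    show (((0 : V), ω.form x.1 x.1) : V × k) = 0
    ext <;> simp [ω.alt]
  leibniz_lie x y z := by
    show (((0 : V), ω.form x.1 ((0 : V), ω.form y.1 z.1).1) : V × k)
      = (((0 : V), ω.form ((0 : V), ω.form x.1 y.1).1 z.1) : V × k)
        + (((0 : V), ω.form y.1 ((0 : V), ω.form x.1 z.1).1) : V × k)
    ext <;> simp
instance : LieAlgebra k (Heisenberg ω) where
  lie_smul t x y := by
    show (((0 : V), ω.form x.1 (t • y).1) : V × k)
      = t • (((0 : V), ω.form x.1 y.1) : V × k)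
    have h1 : (t • y).1 = t • y.1 := rfl
    ext <;> simp [h1]
def zH : Heisenberg ω := (((0 : V), (1 : k)) : V × k)
def ofV (v : V) : Heisenberg ω := ((v, (0 : k)) : V × k)
def ofVk (v : V) (c : k) : Heisenberg ω := ((v, c) : V × k)
end Heisenberg

section Defs

variable (ω : AltBilin k V)
variable (M : Type*) [AddCommGroup M] [Module k M]
  [LieRingModule (Heisenberg ω) M] [LieModule k (Heisenberg ω) M]

/-- The subspace `M^𝔩` of `𝔩`-invariant vectors. -/
def invSub (l : Submodule k V) : Submodule k M where
  carrier := {m : M | ∀ x ∈ l, ⁅Heisenberg.ofV ω x, m⁆ = 0}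
  add_mem' := by
    intro a b ha hb
    intro x hx
    rw [lie_add, ha x hx, hb x hx, add_zero]
  zero_mem' := by intro x hx; simp
  smul_mem' := by
    intro c a ha
    intro x hx
    rw [lie_smul, ha x hx, smul_zero]

/-- The action of the universal enveloping algebra of `𝔥` on `M`. -/
noncomputable def uAct :
    UniversalEnvelopingAlgebra k (Heisenberg ω) →ₐ[k] Module.End k M :=
  UniversalEnvelopingAlgebra.lift k (LieModule.toEnd k (Heisenberg ω) M)

/-- The action map `α : U(𝔥) ⊗ M^𝔩 → M`, `u ⊗ m ↦ u·m`. -/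
noncomputable def alphaMap (l : Submodule k V) :
    (UniversalEnvelopingAlgebra k (Heisenberg ω) ⊗[k] ↥(invSub ω M l)) →ₗ[k] M :=
  TensorProduct.lift
    { toFun := fun u => (uAct ω M u) ∘ₗ (invSub ω M l).subtype
      map_add' := fun u v => by simp [map_add, LinearMap.add_comp]
      map_smul' := fun c u => by simp [map_smul, LinearMap.smul_comp] }

/-- The submodule of relations defining `U(𝔥) ⊗_{U(𝔭)} E(M^𝔩)` as a quotient of
`U(𝔥) ⊗_k M^𝔩`: it is spanned by the elements `(u·ι(x,c)) ⊗ m − u ⊗ (c • z·m)`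
for `x ∈ 𝔩`, `c ∈ k`, `m ∈ M^𝔩` (the `𝔭 = 𝔩 ⊕ 𝔷`-action on `E(M^𝔩)` being
trivial on `𝔩` and by the `z`-action on `𝔷`). -/
noncomputable def relSub (l : Submodule k V) :
    Submodule k (UniversalEnvelopingAlgebra k (Heisenberg ω) ⊗[k] ↥(invSub ω M l)) :=
  Submodule.span k
    {t | ∃ (u : UniversalEnvelopingAlgebra k (Heisenberg ω)) (x : V),
        x ∈ l ∧ ∃ (c : k) (m m' : ↥(invSub ω M l)),
          (m' : M) = c • ⁅Heisenberg.zH ω, (m : M)⁆ ∧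
          t = (u * UniversalEnvelopingAlgebra.ι k (Heisenberg.ofVk ω x c)) ⊗ₜ[k] m
              - u ⊗ₜ[k] m'}

end Defs

namespace UniversalEnvelopingAlgebra

theorem induction_mul_ι {R L : Type*} [CommRing R] [LieRing L] [LieAlgebra R L]
    {p : UniversalEnvelopingAlgebra R L → Prop}
    (algebraMap : ∀ r : R, p (algebraMap R _ r)) (ι : ∀ x : L, p (ι R x))
    (mul : ∀ a b, p a → p b → p (a * b)) (add : ∀ a b, p a → p b → p (a + b))
    (a : UniversalEnvelopingAlgebra R L) : p a := by
  obtain ⟨t, rfl⟩ : ∃ t, mkAlgHom R L t = a := Quotient.exists_rep a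
  induction t using TensorAlgebra.induction with
  | algebraMap r => rw [AlgHom.commutes]; exact algebraMap r
  | ι x => exact ι x
  | mul a b ha hb => rw [map_mul]; exact mul _ _ ha hb
  | add a b ha hb => rw [map_add]; exact add _ _ ha hb

section

attribute [local instance] LieRing.ofAssociativeRing

theorem ι_mul_ι (R : Type*) {L : Type*} [CommRing R] [LieRing L] [LieAlgebra R L] (a b : L) :
    ι R a * ι R b = ι R b * ι R a + ι R ⁅a, b⁆ := by
  rw [(ι R).map_lie, LieRing.of_associative_ring_bracket]
  abel

/-- The canonical map to the universal enveloping algebra as a linear map. -/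
def ιₗ (R L : Type*) [CommRing R] [LieRing L] [LieAlgebra R L] :
    L →ₗ[R] UniversalEnvelopingAlgebra R L where
  toFun := ι R
  map_add' := (ι R).map_add'
  map_smul' := (ι R).map_smul'

theorem ιₗ_apply (R : Type*) {L : Type*} [CommRing R] [LieRing L] [LieAlgebra R L] (a : L) :
    ιₗ R L a = ι R a := rfl

end

end UniversalEnvelopingAlgebra

/-- A family `x` in `l` and a family `y` in `V` that are dual to each other for `ω`, with `x`
spanning `l` and `y` spanning a complement of `l`. -/
structure IsLagrangianFrame {ι : Type*} [Fintype ι] (ω : AltBilin k V) (l : Submodule k V)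
    (x y : ι → V) : Prop where
  mem : ∀ i, x i ∈ l
  isotropic : ∀ v ∈ l, ∀ w ∈ l, ω.form v w = 0
  sub_sum_mem : ∀ v, v - ∑ i, ω.form (x i) v • y i ∈ l
  sum_eq : ∀ v ∈ l, ∑ i, ω.form v (y i) • x i = v

theorem AltBilin.form_neg_swap (ω : AltBilin k V) (v w : V) : ω.form v w = -ω.form w v := by
  have h := ω.alt (v + w)
  simp only [map_add, LinearMap.add_apply, ω.alt] at h
  linear_combination h

theorem exists_isLagrangianFrame [FiniteDimensional k V] (ω : AltBilin k V)
    (hnondeg : ∀ v : V, (∀ w : V, ω.form v w = 0) → v = 0)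
    (l : Submodule k V) (hLag : ∀ v : V, v ∈ l ↔ ∀ x ∈ l, ω.form v x = 0) :
    ∃ x y : Fin (Module.finrank k l) → V, IsLagrangianFrame ω l x y := by
  classical
  let b := Module.finBasis k l
  let f : l →ₗ[k] Module.Dual k V := ω.form ∘ₗ l.subtype
  have hf : Function.Injective f := by
    rw [injective_iff_map_eq_zero]
    intro v hv
    exact Subtype.ext (hnondeg v fun w => LinearMap.congr_fun hv w)
  have hy : ∀ j, ∃ y : V, ∀ v : l, ω.form v y = b.coord j v := by
    intro j
    obtain ⟨φ, hφ⟩ := LinearMap.dualMap_surjective_of_injective hf (b.coord j)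
    obtain ⟨y, rfl⟩ := (Module.evalEquiv k V).surjective φ
    exact ⟨y, fun v => LinearMap.congr_fun hφ v⟩
  choose y hy using hy
  have hsum : ∀ v ∈ l, ∑ i, ω.form v (y i) • (b i : V) = v := by
    intro v hv
    refine Eq.trans ?_ (congrArg Subtype.val (b.sum_repr ⟨v, hv⟩))
    simp only [AddSubmonoidClass.coe_finsetSum, Submodule.coe_smul]
    exact Finset.sum_congr rfl fun i _ => congrArg (· • (b i : V)) (hy i ⟨v, hv⟩)
  refine ⟨fun i => b i, y, fun i => (b i).2, fun v hv w hw => (hLag v).1 hv w hw, ?_, hsum⟩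
  intro v
  rw [hLag]
  intro w hw
  conv_lhs => rw [map_sub, LinearMap.sub_apply]
  nth_rewrite 1 [← hsum w hw]
  simp only [map_sum, map_smul, LinearMap.sum_apply, LinearMap.smul_apply, smul_eq_mul,
    ← Finset.sum_sub_distrib]
  refine Finset.sum_eq_zero fun i _ => ?_
  rw [ω.form_neg_swap v, ω.form_neg_swap (y i)]
  ring

/-- Operators `ρ v` on `N` satisfying the canonical commutation relations for `ω`, with central
operator `Z`. -/
structure IsCCR {N : Type*} [AddCommGroup N] [Module k N] (ω : AltBilin k V)
    (ρ : V →ₗ[k] Module.End k N) (Z : Module.End k N) : Prop where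
  comm : ∀ v w n, ρ v (ρ w n) = ρ w (ρ v n) + ω.form v w • Z n
  central : ∀ v n, ρ v (Z n) = Z (ρ v n)

section CCR

variable {N : Type*} [AddCommGroup N] [Module k N] {ω : AltBilin k V}
  {ρ : V →ₗ[k] Module.End k N} {Z : Module.End k N}
  {ι : Type*} [Fintype ι] {l : Submodule k V} {x y : ι → V}

/-- The Euler operator `∑ y i * x i`. -/
def euler (ρ : V →ₗ[k] Module.End k N) (x y : ι → V) : Module.End k N :=
  ∑ i, ρ (y i) ∘ₗ ρ (x i)

theorem euler_apply (n : N) : euler ρ x y n = ∑ i, ρ (y i) (ρ (x i) n) := by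
  simp [euler]

theorem IsCCR.comm_euler (h : IsCCR ω ρ Z) (hxy : IsLagrangianFrame ω l x y) {v : V}
    (hv : v ∈ l) (n : N) : ρ v (euler ρ x y n) = euler ρ x y (ρ v n) + Z (ρ v n) := by
  have key : ∀ i, ρ v (ρ (y i) (ρ (x i) n)) =
      ρ (y i) (ρ (x i) (ρ v n)) + Z (ρ (ω.form v (y i) • x i) n) := by
    intro i
    rw [h.comm, h.comm v (x i), hxy.isotropic v hv _ (hxy.mem i), zero_smul, add_zero]
    simp
  simp only [euler_apply, map_sum, key, Finset.sum_add_distrib]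
  congr 1
  conv_rhs => rw [← hxy.sum_eq v hv]
  simp [map_sum]

theorem IsCCR.exists_euler_comm (h : IsCCR ω ρ Z) (hxy : IsLagrangianFrame ω l x y) (v : V) :
    ∃ w ∈ l, ∀ n, euler ρ x y (ρ v n) = ρ v (euler ρ x y n) + Z (ρ v n) + Z (ρ w n) := by
  refine ⟨∑ i, ω.form (y i) v • x i - (v - ∑ i, ω.form (x i) v • y i),
    l.sub_mem (l.sum_mem fun i _ => l.smul_mem _ (hxy.mem i)) (hxy.sub_sum_mem v), fun n => ?_⟩
  have key : ∀ i, ρ (y i) (ρ (x i) (ρ v n)) = ρ v (ρ (y i) (ρ (x i) n)) +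
      (ω.form (y i) v • Z (ρ (x i) n) + ω.form (x i) v • Z (ρ (y i) n)) := by
    intro i
    rw [h.comm (x i), map_add, h.comm (y i) v, map_smul, h.central, add_assoc]
  simp only [euler_apply, map_sum, key, Finset.sum_add_distrib]
  simp only [map_sub, map_sum, map_smul, LinearMap.sub_apply, LinearMap.sum_apply,
    LinearMap.smul_apply]
  abel

/-- The vectors killed by all products of `d` operators from `l`. -/
def nilFiltration (ρ : V →ₗ[k] Module.End k N) (l : Submodule k V) : ℕ → Submodule k N
  | 0 => ⊥
  | d + 1 => ⨅ v : l, (nilFiltration ρ l d).comap (ρ v)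

theorem mem_nilFiltration_succ {d : ℕ} {n : N} :
    n ∈ nilFiltration ρ l (d + 1) ↔ ∀ v ∈ l, ρ v n ∈ nilFiltration ρ l d := by
  simp [nilFiltration, Submodule.mem_iInf]

theorem IsCCR.central_mem_nilFiltration_iff (h : IsCCR ω ρ Z) (hZ : Function.Injective Z) {d : ℕ}
    {n : N} : Z n ∈ nilFiltration ρ l d ↔ n ∈ nilFiltration ρ l d := by
  induction d generalizing n with
  | zero =>
    change Z n = 0 ↔ n = 0
    rw [map_eq_zero_iff Z hZ]
  | succ d ih => simp only [mem_nilFiltration_succ, h.central, ih]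

theorem IsCCR.euler_sub_mem_nilFiltration (h : IsCCR ω ρ Z) (hxy : IsLagrangianFrame ω l x y)
    {d : ℕ} {n : N} (hn : n ∈ nilFiltration ρ l (d + 1)) :
    euler ρ x y n - d • Z n ∈ nilFiltration ρ l d := by
  induction d generalizing n with
  | zero =>
    rw [mem_nilFiltration_succ] at hn
    change _ = (0 : N)
    rw [euler_apply, zero_smul, sub_zero]
    refine Finset.sum_eq_zero fun i _ => ?_
    rw [show ρ (x i) n = 0 from hn _ (hxy.mem i), map_zero]
  | succ d ih =>
    rw [mem_nilFiltration_succ] at hn ⊢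
    intro v hv
    convert ih (hn v hv) using 1
    rw [map_sub, h.comm_euler hxy hv, map_nsmul, h.central, succ_nsmul]
    abel

theorem IsCCR.exists_mem_nilFiltration (h : IsCCR ω ρ Z) (hxy : IsLagrangianFrame ω l x y)
    (hnil : ∀ v ∈ l, ∀ n, ∃ i : ℕ, (ρ v ^ i) n = 0) (n : N) : ∃ d, n ∈ nilFiltration ρ l d := by
  classical
  have key : ∀ (d : ℕ) (a : ι → ℕ) (n : N), ∑ i, a i ≤ d → (∀ i, (ρ (x i) ^ a i) n = 0) →
      n ∈ nilFiltration ρ l (d + 1) := by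
    intro d
    induction d with
    | zero =>
      intro a n ha hn
      rw [mem_nilFiltration_succ]
      intro v hv
      rw [← hxy.sum_eq v hv]
      simp only [map_sum, map_smul, LinearMap.sum_apply, LinearMap.smul_apply]
      refine Submodule.sum_mem _ fun i _ => Submodule.smul_mem _ _ ?_
      have hi : a i = 0 := by
        have := Finset.single_le_sum (f := a) (fun _ _ => Nat.zero_le _) (Finset.mem_univ i)
        omega
      have := hn i
      rw [hi, pow_zero, Module.End.one_apply] at this
      rw [this, map_zero]
      exact Submodule.zero_mem _
    | succ d ih =>
      intro a n ha hn
      rw [mem_nilFiltration_succ]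
      intro v hv
      rw [← hxy.sum_eq v hv]
      simp only [map_sum, map_smul, LinearMap.sum_apply, LinearMap.smul_apply]
      refine Submodule.sum_mem _ fun i _ => Submodule.smul_mem _ _ ?_
      have hc : ∀ j, Commute (ρ (x j)) (ρ (x i)) := fun j => LinearMap.ext fun m => by
        have := h.comm (x j) (x i) m
        rwa [hxy.isotropic _ (hxy.mem j) _ (hxy.mem i), zero_smul, add_zero] at this
      by_cases hi : a i = 0
      · have := hn i
        rw [hi, pow_zero, Module.End.one_apply] at this
        rw [this, map_zero]
        exact Submodule.zero_mem _
      · refine ih (Function.update a i (a i - 1)) _ ?_ fun j => ?_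
        · have hlt : ∑ j, Function.update a i (a i - 1) j < ∑ j, a j := by
            refine Finset.sum_lt_sum (fun j _ => ?_) ⟨i, Finset.mem_univ i, ?_⟩
            · by_cases hj : j = i
              · subst hj; simp
              · simp [hj]
            · simp; omega
          omega
        · by_cases hj : j = i
          · subst hj
            rw [Function.update_self, ← Module.End.mul_apply, ← pow_succ,
              Nat.sub_add_cancel (Nat.pos_of_ne_zero hi)]
            exact hn j
          · rw [Function.update_of_ne hj, ← Module.End.mul_apply, ((hc j).pow_left _).eq,
              Module.End.mul_apply, hn j, map_zero]
  choose a ha using fun i => hnil (x i) (hxy.mem i) n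
  exact ⟨_, key _ a n le_rfl ha⟩

/-- A submodule stable under all `ρ v` and `Z` and containing the vectors killed by `l` contains
every vector that is nilpotent under `l`. -/
theorem IsCCR.nilFiltration_le [CharZero k] (h : IsCCR ω ρ Z) (hxy : IsLagrangianFrame ω l x y)
    (hZ : Function.Bijective Z) {P : Submodule k N} (hP : ∀ v, ∀ n ∈ P, ρ v n ∈ P)
    (hker : ∀ n, (∀ v ∈ l, ρ v n = 0) → n ∈ P) (d : ℕ) : nilFiltration ρ l d ≤ P := by
  induction d with
  | zero => exact bot_le
  | succ d ih =>
    rintro m hm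
    obtain ⟨n, rfl⟩ := hZ.2 m
    rw [h.central_mem_nilFiltration_iff hZ.1] at hm
    rcases Nat.eq_zero_or_pos d with rfl | hd
    · refine hker _ fun v hv => ?_
      rw [h.central, show ρ v n = 0 from mem_nilFiltration_succ.1 hm v hv, map_zero]
    · have hE : euler ρ x y n ∈ P := by
        rw [euler_apply]
        exact P.sum_mem fun i _ => hP _ _ (ih (mem_nilFiltration_succ.1 hm _ (hxy.mem i)))
      have hs := P.sub_mem hE (ih (h.euler_sub_mem_nilFiltration hxy hm))
      rw [sub_sub_cancel, ← Nat.cast_smul_eq_nsmul k] at hs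
      exact (P.smul_mem_iff (Nat.cast_ne_zero.2 hd.ne')).1 hs

/-- The span of the products of less than `d` operators `ρ v` applied to `S`. -/
def genFiltration (ρ : V →ₗ[k] Module.End k N) (S : Submodule k N) : ℕ → Submodule k N
  | 0 => ⊥
  | d + 1 => S ⊔ ⨆ v, (genFiltration ρ S d).map (ρ v)

variable {S : Submodule k N}

theorem le_genFiltration_succ (d : ℕ) : S ≤ genFiltration ρ S (d + 1) := le_sup_left

theorem apply_mem_genFiltration {d : ℕ} (v : V) {n : N} (hn : n ∈ genFiltration ρ S d) :
    ρ v n ∈ genFiltration ρ S (d + 1) :=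
  (le_sup_of_le_right (le_iSup (fun v => (genFiltration ρ S d).map (ρ v)) v))
    (Submodule.mem_map_of_mem hn)

theorem genFiltration_succ_le {d : ℕ} {P : Submodule k N} (hS : S ≤ P)
    (hP : ∀ v, ∀ n ∈ genFiltration ρ S d, ρ v n ∈ P) : genFiltration ρ S (d + 1) ≤ P :=
  sup_le hS (iSup_le fun v => Submodule.map_le_iff_le_comap.2 (hP v))

theorem genFiltration_mono : Monotone (genFiltration ρ S) := by
  refine monotone_nat_of_le_succ fun d => ?_
  induction d with
  | zero => exact bot_le
  | succ d ih =>
    exact genFiltration_succ_le (le_genFiltration_succ _) fun v n hn =>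
      apply_mem_genFiltration v (ih hn)

theorem genFiltration_one_le : genFiltration ρ S 1 ≤ S :=
  genFiltration_succ_le le_rfl fun v n hn => by
    rw [show n = 0 from hn, map_zero]
    exact S.zero_mem

theorem IsCCR.central_mem_genFiltration (h : IsCCR ω ρ Z) (hZS : ∀ n ∈ S, Z n ∈ S) (d : ℕ) :
    ∀ n ∈ genFiltration ρ S d, Z n ∈ genFiltration ρ S d := by
  induction d with
  | zero =>
    intro n hn
    rw [show n = 0 from hn, map_zero]
    exact Submodule.zero_mem _
  | succ d ih =>
    refine genFiltration_succ_le (P := (genFiltration ρ S (d + 1)).comap Z)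
      (fun n hn => le_genFiltration_succ d (hZS n hn)) fun v n hn => ?_
    rw [Submodule.mem_comap, ← h.central]
    exact apply_mem_genFiltration v (ih n hn)

theorem IsCCR.lower_mem_genFiltration (h : IsCCR ω ρ Z) (hZS : ∀ n ∈ S, Z n ∈ S)
    (hS : ∀ v ∈ l, ∀ n ∈ S, ρ v n = 0) {w : V} (hw : w ∈ l) (d : ℕ) :
    ∀ n ∈ genFiltration ρ S (d + 1), ρ w n ∈ genFiltration ρ S d := by
  induction d with
  | zero =>
    intro n hn
    rw [hS w hw n (genFiltration_one_le hn)]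
    exact Submodule.zero_mem _
  | succ d ih =>
    refine genFiltration_succ_le (P := (genFiltration ρ S (d + 1)).comap (ρ w))
      (fun n hn => ?_) fun v n hn => ?_
    · rw [Submodule.mem_comap, hS w hw n hn]
      exact Submodule.zero_mem _
    · rw [Submodule.mem_comap, h.comm]
      exact Submodule.add_mem _ (apply_mem_genFiltration v (ih n hn))
        (Submodule.smul_mem _ _ (h.central_mem_genFiltration hZS _ _ hn))

theorem IsCCR.euler_sub_mem_genFiltration (h : IsCCR ω ρ Z) (hxy : IsLagrangianFrame ω l x y)
    (hZS : ∀ n ∈ S, Z n ∈ S) (hS : ∀ v ∈ l, ∀ n ∈ S, ρ v n = 0) (d : ℕ) :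
    ∀ n ∈ genFiltration ρ S (d + 1), euler ρ x y n - d • Z n ∈ genFiltration ρ S d := by
  have hES : ∀ n ∈ S, euler ρ x y n = 0 := fun n hn => by
    rw [euler_apply]
    exact Finset.sum_eq_zero fun i _ => by rw [hS _ (hxy.mem i) n hn, map_zero]
  induction d with
  | zero =>
    intro n hn
    rw [hES n (genFiltration_one_le hn), zero_smul, sub_zero]
    exact Submodule.zero_mem _
  | succ d ih =>
    refine genFiltration_succ_le
      (P := (genFiltration ρ S (d + 1)).comap (euler ρ x y - (d + 1) • Z))
      (fun n hn => ?_) fun v n hn => ?_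
    · change euler ρ x y n - (d + 1) • Z n ∈ genFiltration ρ S (d + 1)
      rw [hES n hn, zero_sub]
      exact Submodule.neg_mem _ (Submodule.smul_of_tower_mem _ _
        (le_genFiltration_succ d (hZS n hn)))
    · change euler ρ x y (ρ v n) - (d + 1) • Z (ρ v n) ∈ genFiltration ρ S (d + 1)
      obtain ⟨w, hw, hvw⟩ := h.exists_euler_comm hxy v
      have heq : euler ρ x y (ρ v n) - (d + 1) • Z (ρ v n) =
          ρ v (euler ρ x y n - d • Z n) + Z (ρ w n) := by
        rw [hvw, map_sub, map_nsmul, h.central, succ_nsmul]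
        abel
      rw [heq]
      exact Submodule.add_mem _ (apply_mem_genFiltration v (ih n hn))
        (h.central_mem_genFiltration hZS _ _
          (genFiltration_mono d.le_succ (h.lower_mem_genFiltration hZS hS hw d n hn)))

/-- An intertwiner that is injective on a space `S` of vectors killed by `l` is injective on the
submodule generated by `S`. -/
theorem IsCCR.eq_zero_of_mem_genFiltration [CharZero k] (h : IsCCR ω ρ Z)
    (hxy : IsLagrangianFrame ω l x y) (hZ : Function.Injective Z)
    (hZS : ∀ n ∈ S, Z n ∈ S) (hS : ∀ v ∈ l, ∀ n ∈ S, ρ v n = 0)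
    {M : Type*} [AddCommGroup M] [Module k M] (f : N →ₗ[k] M)
    (hfS : ∀ n ∈ S, f n = 0 → n = 0)
    (hfρ : ∀ v n, f n = 0 → f (ρ v n) = 0) (hfZ : ∀ n, f n = 0 → f (Z n) = 0) (d : ℕ) :
    ∀ n ∈ genFiltration ρ S d, f n = 0 → n = 0 := by
  induction d with
  | zero => exact fun n hn _ => hn
  | succ d ih =>
    intro n hn hfn
    rcases Nat.eq_zero_or_pos d with rfl | hd
    · exact hfS n (genFiltration_one_le hn) hfn
    · have hE : euler ρ x y n = 0 := by
        rw [euler_apply]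
        refine Finset.sum_eq_zero fun i _ => ?_
        rw [ih _ (h.lower_mem_genFiltration hZS hS (hxy.mem i) d n hn) (hfρ _ _ hfn), map_zero]
      have hs := h.euler_sub_mem_genFiltration hxy hZS hS d n hn
      rw [hE, zero_sub, Submodule.neg_mem_iff, ← Nat.cast_smul_eq_nsmul k,
        Submodule.smul_mem_iff _ (Nat.cast_ne_zero.2 hd.ne')] at hs
      exact (map_eq_zero_iff Z hZ).1 (ih _ hs (hfZ _ hfn))

end CCR

namespace Heisenberg

variable (ω : AltBilin k V)

/-- The inclusion of `V` in the Heisenberg Lie algebra as a linear map. -/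
def ofVₗ : V →ₗ[k] Heisenberg ω := LinearMap.inl k V k

theorem ofVₗ_apply (v : V) : ofVₗ ω v = ofV ω v := rfl

theorem lie_ofV (v w : V) : ⁅ofV ω v, ofV ω w⁆ = ω.form v w • zH ω :=
  show (((0 : V), ω.form v w) : V × k) = ω.form v w • ((0 : V), (1 : k)) by simp

theorem lie_zH (h : Heisenberg ω) : ⁅h, zH ω⁆ = 0 :=
  show (((0 : V), ω.form h.1 0) : V × k) = 0 by simp

theorem ofVk_eq (v : V) (c : k) : ofVk ω v c = ofV ω v + c • zH ω :=
  show ((v, c) : V × k) = (v, (0 : k)) + c • ((0 : V), (1 : k)) by ext <;> simp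

variable {ω} in
theorem lie_zH_comm {M : Type*} [AddCommGroup M] [LieRingModule (Heisenberg ω) M]
    (h : Heisenberg ω) (m : M) : ⁅h, ⁅zH ω, m⁆⁆ = ⁅zH ω, ⁅h, m⁆⁆ := by
  rw [leibniz_lie, lie_zH, zero_lie, zero_add]

end Heisenberg

section Induced

open Heisenberg

variable {ω : AltBilin k V} {M : Type*} [AddCommGroup M] [Module k M]
  [LieRingModule (Heisenberg ω) M] [LieModule k (Heisenberg ω) M] {l : Submodule k V}

theorem ι_mul_ι_ofV (v w : V) :
    UniversalEnvelopingAlgebra.ι k (ofV ω v) * UniversalEnvelopingAlgebra.ι k (ofV ω w) =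
      UniversalEnvelopingAlgebra.ι k (ofV ω w) * UniversalEnvelopingAlgebra.ι k (ofV ω v) +
        ω.form v w • UniversalEnvelopingAlgebra.ι k (zH ω) := by
  rw [UniversalEnvelopingAlgebra.ι_mul_ι, lie_ofV]
  congr 1
  exact (UniversalEnvelopingAlgebra.ιₗ k (Heisenberg ω)).map_smul _ _

theorem commute_ι_zH (u : UniversalEnvelopingAlgebra k (Heisenberg ω)) :
    Commute u (UniversalEnvelopingAlgebra.ι k (zH ω)) := by
  induction u using UniversalEnvelopingAlgebra.induction_mul_ι with
  | algebraMap r => exact Algebra.commutes r _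
  | ι h =>
    rw [commute_iff_eq, UniversalEnvelopingAlgebra.ι_mul_ι, lie_zH, add_eq_left]
    exact (UniversalEnvelopingAlgebra.ιₗ k (Heisenberg ω)).map_zero
  | mul a b ha hb => exact ha.mul_left hb
  | add a b ha hb => exact ha.add_left hb

theorem lie_zH_mem_invSub {m : M} (hm : m ∈ invSub ω M l) : ⁅zH ω, m⁆ ∈ invSub ω M l :=
  fun x hx => by rw [lie_zH_comm, hm x hx, lie_zero]

theorem mem_invSub_of_lie_zH (hz : Function.Injective fun m : M => ⁅zH ω, m⁆) {m : M}
    (hm : ⁅zH ω, m⁆ ∈ invSub ω M l) : m ∈ invSub ω M l :=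
  fun x hx => hz <| by
    change ⁅zH ω, ⁅ofV ω x, m⁆⁆ = ⁅zH ω, (0 : M)⁆
    rw [← lie_zH_comm, hm x hx, lie_zero]

theorem uAct_ι (h : Heisenberg ω) (m : M) :
    uAct ω M (UniversalEnvelopingAlgebra.ι k h) m = ⁅h, m⁆ := by
  rw [uAct, UniversalEnvelopingAlgebra.lift_ι_apply]
  rfl

theorem alphaMap_tmul (u : UniversalEnvelopingAlgebra k (Heisenberg ω)) (m : invSub ω M l) :
    alphaMap ω M l (u ⊗ₜ[k] m) = uAct ω M u m := rfl

theorem alphaMap_mul_rTensor (u : UniversalEnvelopingAlgebra k (Heisenberg ω))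
    (t : UniversalEnvelopingAlgebra k (Heisenberg ω) ⊗[k] invSub ω M l) :
    alphaMap ω M l ((LinearMap.mulLeft k u).rTensor _ t) = uAct ω M u (alphaMap ω M l t) := by
  induction t using TensorProduct.induction_on with
  | zero => simp only [map_zero]
  | tmul a m =>
    rw [LinearMap.rTensor_tmul, alphaMap_tmul, alphaMap_tmul, LinearMap.mulLeft_apply, map_mul,
      Module.End.mul_apply]
  | add a b ha hb => simp only [map_add, ha, hb]

theorem relSub_le_ker : relSub ω M l ≤ LinearMap.ker (alphaMap ω M l) := by
  refine Submodule.span_le.2 ?_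
  rintro _ ⟨u, x, hx, c, m, m', hm', rfl⟩
  rw [SetLike.mem_coe, LinearMap.mem_ker, map_sub, alphaMap_tmul, alphaMap_tmul, map_mul,
    Module.End.mul_apply, uAct_ι, ofVk_eq, add_lie, m.2 x hx, zero_add, smul_lie, hm', sub_self]

theorem relSub_le_comap_rTensor (u : UniversalEnvelopingAlgebra k (Heisenberg ω)) :
    relSub ω M l ≤ (relSub ω M l).comap ((LinearMap.mulLeft k u).rTensor (invSub ω M l)) := by
  refine Submodule.span_le.2 ?_
  rintro _ ⟨a, x, hx, c, m, m', hm', rfl⟩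
  refine Submodule.subset_span ⟨u * a, x, hx, c, m, m', hm', ?_⟩
  rw [map_sub, LinearMap.rTensor_tmul, LinearMap.rTensor_tmul, LinearMap.mulLeft_apply,
    LinearMap.mulLeft_apply, mul_assoc]

variable (ω M l) in
/-- The induced module `U(𝔥) ⊗_{U(𝔭)} M^𝔩`. -/
abbrev Induced : Type _ :=
  (UniversalEnvelopingAlgebra k (Heisenberg ω) ⊗[k] invSub ω M l) ⧸ relSub ω M l

variable (ω M l) in
/-- The action of `U(𝔥)` on the induced module by left multiplication. -/
noncomputable def inducedAct :
    UniversalEnvelopingAlgebra k (Heisenberg ω) →ₗ[k] Module.End k (Induced ω M l) where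
  toFun u := (relSub ω M l).mapQ _ ((LinearMap.mulLeft k u).rTensor _) (relSub_le_comap_rTensor u)
  map_add' u v := by
    refine Submodule.linearMap_qext _ (TensorProduct.ext' fun a m => ?_)
    simp [add_mul, TensorProduct.add_tmul]
  map_smul' c u := by
    refine Submodule.linearMap_qext _ (TensorProduct.ext' fun a m => ?_)
    change (relSub ω M l).mkQ ((c • u * a) ⊗ₜ m) = c • (relSub ω M l).mkQ ((u * a) ⊗ₜ m)
    rw [smul_mul_assoc, ← TensorProduct.smul_tmul', map_smul]

theorem inducedAct_mk (u : UniversalEnvelopingAlgebra k (Heisenberg ω))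
    (t : UniversalEnvelopingAlgebra k (Heisenberg ω) ⊗[k] invSub ω M l) :
    inducedAct ω M l u ((relSub ω M l).mkQ t) =
      (relSub ω M l).mkQ ((LinearMap.mulLeft k u).rTensor _ t) := rfl

theorem inducedAct_mk_tmul (u a : UniversalEnvelopingAlgebra k (Heisenberg ω))
    (m : invSub ω M l) :
    inducedAct ω M l u ((relSub ω M l).mkQ (a ⊗ₜ m)) = (relSub ω M l).mkQ ((u * a) ⊗ₜ m) := rfl

theorem inducedAct_mul (u v : UniversalEnvelopingAlgebra k (Heisenberg ω)) :
    inducedAct ω M l (u * v) = inducedAct ω M l u * inducedAct ω M l v := by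
  refine Submodule.linearMap_qext _ (TensorProduct.ext' fun a m => ?_)
  simp only [LinearMap.comp_apply, Module.End.mul_apply, inducedAct_mk_tmul, mul_assoc]

theorem mk_mul_ι_tmul (u : UniversalEnvelopingAlgebra k (Heisenberg ω)) {x : V} (hx : x ∈ l)
    (m : invSub ω M l) :
    (relSub ω M l).mkQ ((u * UniversalEnvelopingAlgebra.ι k (ofV ω x)) ⊗ₜ m) = 0 := by
  rw [Submodule.mkQ_apply, Submodule.Quotient.mk_eq_zero]
  exact Submodule.subset_span ⟨u, x, hx, 0, m, 0, by simp, by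
    rw [ofVk_eq, zero_smul, add_zero, TensorProduct.tmul_zero, sub_zero]⟩

theorem inducedAct_ι_zH_mk_tmul (u : UniversalEnvelopingAlgebra k (Heisenberg ω))
    (m : invSub ω M l) :
    inducedAct ω M l (UniversalEnvelopingAlgebra.ι k (zH ω)) ((relSub ω M l).mkQ (u ⊗ₜ m)) =
      (relSub ω M l).mkQ (u ⊗ₜ ⟨⁅zH ω, (m : M)⁆, lie_zH_mem_invSub m.2⟩) := by
  rw [inducedAct_mk_tmul, ← (commute_ι_zH u).eq, ← sub_eq_zero, ← map_sub, Submodule.mkQ_apply,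
    Submodule.Quotient.mk_eq_zero]
  refine Submodule.subset_span ⟨u, 0, l.zero_mem, 1, m, ⟨_, lie_zH_mem_invSub m.2⟩, (one_smul k _).symm, ?_⟩
  rw [ofVk_eq, one_smul, ← ofVₗ_apply, map_zero, zero_add]

theorem inducedAct_ι_zH_injective (hz : Function.Bijective fun m : M => ⁅zH ω, m⁆) :
    Function.Injective (inducedAct ω M l (UniversalEnvelopingAlgebra.ι k (zH ω))) := by
  let e : M ≃ₗ[k] M := LinearEquiv.ofBijective (LieModule.toEnd k (Heisenberg ω) M (zH ω)) hz
  have he : ∀ m, ⁅zH ω, e.symm m⁆ = m := e.apply_symm_apply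
  have he' : ∀ m, e.symm ⁅zH ω, m⁆ = m := e.symm_apply_apply
  let W : invSub ω M l →ₗ[k] invSub ω M l := (e.symm : M →ₗ[k] M).restrict fun m hm =>
    mem_invSub_of_lie_zH hz.1 (by rw [LinearEquiv.coe_coe, he]; exact hm)
  have hW : ∀ m, (W m : M) = e.symm m := fun m => rfl
  have hrel : relSub ω M l ≤ (relSub ω M l).comap
      (W.lTensor (UniversalEnvelopingAlgebra k (Heisenberg ω))) := by
    refine Submodule.span_le.2 ?_
    rintro _ ⟨u, x, hx, c, m, m', hm', rfl⟩
    refine Submodule.subset_span ⟨u, x, hx, c, W m, W m', ?_, ?_⟩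
    · rw [hW, hW, hm', map_smul, he', he]
    · rw [map_sub, LinearMap.lTensor_tmul, LinearMap.lTensor_tmul]
  have hleft : (relSub ω M l).mapQ _ _ hrel ∘ₗ
      inducedAct ω M l (UniversalEnvelopingAlgebra.ι k (zH ω)) = LinearMap.id := by
    refine Submodule.linearMap_qext _ (TensorProduct.ext' fun u m => ?_)
    rw [LinearMap.comp_apply, LinearMap.comp_apply, inducedAct_ι_zH_mk_tmul]
    change (relSub ω M l).mkQ (u ⊗ₜ W _) = (relSub ω M l).mkQ (u ⊗ₜ m)
    congr 2
    exact Subtype.ext (he' m)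
  exact Function.LeftInverse.injective (LinearMap.congr_fun hleft)

variable (ω M) in
theorem isCCR_toEnd :
    IsCCR ω ((LieModule.toEnd k (Heisenberg ω) M : Heisenberg ω →ₗ[k] Module.End k M) ∘ₗ ofVₗ ω)
      (LieModule.toEnd k (Heisenberg ω) M (zH ω)) where
  comm v w m := by
    change ⁅ofV ω v, ⁅ofV ω w, m⁆⁆ = ⁅ofV ω w, ⁅ofV ω v, m⁆⁆ + ω.form v w • ⁅zH ω, m⁆
    rw [leibniz_lie, lie_ofV, smul_lie, add_comm]
  central v m := lie_zH_comm _ m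

variable (ω M l) in
theorem isCCR_inducedAct :
    IsCCR ω (inducedAct ω M l ∘ₗ UniversalEnvelopingAlgebra.ιₗ k _ ∘ₗ ofVₗ ω)
      (inducedAct ω M l (UniversalEnvelopingAlgebra.ι k (zH ω))) where
  comm v w q := by
    have h := congrArg (fun u => inducedAct ω M l u q) (ι_mul_ι_ofV (ω := ω) v w)
    simp only [inducedAct_mul, map_add, map_smul] at h
    exact h
  central v q := by
    have h := congrArg (fun u => inducedAct ω M l u q) (commute_ι_zH (UniversalEnvelopingAlgebra.ι k (ofV ω v))).eq
    simp only [inducedAct_mul] at h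
    exact h

variable (ω M l) in
/-- The image of `M^𝔩` in the induced module. -/
noncomputable def inducedBase : Submodule k (Induced ω M l) :=
  LinearMap.range ((relSub ω M l).mkQ ∘ₗ
    TensorProduct.mk k (UniversalEnvelopingAlgebra k (Heisenberg ω)) (invSub ω M l) 1)

theorem exists_mkQ_mem_genFiltration
    (t : UniversalEnvelopingAlgebra k (Heisenberg ω) ⊗[k] invSub ω M l) :
    ∃ d, (relSub ω M l).mkQ t ∈ genFiltration
      (inducedAct ω M l ∘ₗ UniversalEnvelopingAlgebra.ιₗ k _ ∘ₗ ofVₗ ω) (inducedBase ω M l) d := by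
  set ρ := inducedAct ω M l ∘ₗ UniversalEnvelopingAlgebra.ιₗ k _ ∘ₗ ofVₗ ω
  have hccr := isCCR_inducedAct ω M l
  have hZS : ∀ q ∈ inducedBase ω M l,
      inducedAct ω M l (UniversalEnvelopingAlgebra.ι k (zH ω)) q ∈ inducedBase ω M l := by
    rintro _ ⟨m, rfl⟩
    exact ⟨_, (inducedAct_ι_zH_mk_tmul 1 m).symm⟩
  let P : Submodule k (Induced ω M l) := ⨆ d, genFiltration ρ (inducedBase ω M l) d
  have hmem : ∀ q, q ∈ P ↔ ∃ d, q ∈ genFiltration ρ (inducedBase ω M l) d := fun q =>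
    Submodule.mem_iSup_of_directed _ genFiltration_mono.directed_le
  rw [← hmem]
  have hact : ∀ u, ∀ q ∈ P, inducedAct ω M l u q ∈ P := by
    intro u
    induction u using UniversalEnvelopingAlgebra.induction_mul_ι with
    | algebraMap r =>
      intro q hq
      obtain ⟨s, rfl⟩ := (relSub ω M l).mkQ_surjective q
      have h1 : inducedAct ω M l 1 ((relSub ω M l).mkQ s) = (relSub ω M l).mkQ s := by
        rw [inducedAct_mk, LinearMap.mulLeft_one, LinearMap.rTensor_id, LinearMap.id_apply]
      rw [Algebra.algebraMap_eq_smul_one, map_smul, LinearMap.smul_apply, h1]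
      exact P.smul_mem r hq
    | ι h =>
      intro q hq
      obtain ⟨d, hd⟩ := (hmem q).1 hq
      rw [show h = ofV ω h.1 + h.2 • zH ω from ofVk_eq ω h.1 h.2,
        ← UniversalEnvelopingAlgebra.ιₗ_apply, map_add, map_smul, map_add, map_smul,
        LinearMap.add_apply, LinearMap.smul_apply]
      exact P.add_mem ((hmem _).2 ⟨d + 1, apply_mem_genFiltration (ρ := ρ) h.1 hd⟩)
        (P.smul_mem _ ((hmem _).2 ⟨d, hccr.central_mem_genFiltration hZS d q hd⟩))
    | mul a b ha hb =>
      intro q hq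
      rw [inducedAct_mul]
      exact ha _ (hb _ hq)
    | add a b ha hb =>
      intro q hq
      rw [map_add]
      exact P.add_mem (ha _ hq) (hb _ hq)
  induction t using TensorProduct.induction_on with
  | zero => rw [map_zero]; exact P.zero_mem
  | tmul u m =>
    rw [← mul_one u, ← inducedAct_mk_tmul]
    exact hact _ _ ((hmem _).2 ⟨1, le_genFiltration_succ 0 ⟨m, rfl⟩⟩)
  | add a b ha hb => rw [map_add]; exact P.add_mem ha hb

theorem mem_relSub_of_alphaMap_eq_zero [CharZero k] {ι : Type*} [Fintype ι] {x y : ι → V}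
    (hxy : IsLagrangianFrame ω l x y) (hz : Function.Bijective fun m : M => ⁅zH ω, m⁆)
    {t : UniversalEnvelopingAlgebra k (Heisenberg ω) ⊗[k] invSub ω M l}
    (ht : alphaMap ω M l t = 0) : t ∈ relSub ω M l := by
  let f : Induced ω M l →ₗ[k] M := (relSub ω M l).liftQ (alphaMap ω M l) relSub_le_ker
  have hf : ∀ u q, f (inducedAct ω M l u q) = uAct ω M u (f q) := by
    intro u q
    obtain ⟨s, rfl⟩ := (relSub ω M l).mkQ_surjective q
    exact alphaMap_mul_rTensor u s
  have hf0 : ∀ u q, f q = 0 → f (inducedAct ω M l u q) = 0 := fun u q hq => by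
    rw [hf, hq, map_zero]
  obtain ⟨d, hd⟩ := exists_mkQ_mem_genFiltration t
  rw [← Submodule.Quotient.mk_eq_zero]
  refine (isCCR_inducedAct ω M l).eq_zero_of_mem_genFiltration hxy (inducedAct_ι_zH_injective hz)
    ?_ ?_ f ?_ (fun v => hf0 _) (hf0 _) d _ hd ht
  · rintro _ ⟨m, rfl⟩
    exact ⟨_, (inducedAct_ι_zH_mk_tmul 1 m).symm⟩
  · rintro v hv _ ⟨m, rfl⟩
    refine (inducedAct_mk_tmul _ 1 m).trans ?_
    rw [mul_one, ← one_mul ((UniversalEnvelopingAlgebra.ιₗ k _ ∘ₗ ofVₗ ω) v)]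
    exact mk_mul_ι_tmul 1 hv m
  · rintro _ ⟨m, rfl⟩ hm
    have hm0 : uAct ω M 1 (m : M) = 0 := hm
    rw [map_one, Module.End.one_apply, Submodule.coe_eq_zero] at hm0
    rw [hm0, map_zero]

end Induced

/-- Proposition `prop:Kash`: for a module `M` over the Heisenberg
Lie algebra `𝔥` of a finite-dimensional symplectic space `(V, ω)` over a field of
characteristic zero, on which a Lagrangian `𝔩` acts locally nilpotently and the
central element `z` acts invertibly, the natural map
`α : U(𝔥) ⊗_{U(𝔭)} M^𝔩 → M`, `u ⊗ m ↦ u·m` is an isomorphism of `𝔥`-modules.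
Here `U(𝔥) ⊗_{U(𝔭)} M^𝔩` is presented as the quotient of `U(𝔥) ⊗_k M^𝔩` by the
relation submodule `relSub`; the statement is that `α` is `𝔥`-equivariant (for
left multiplication on the first factor), has kernel exactly `relSub`, and is
surjective, i.e. the induced map on the quotient is an `𝔥`-module isomorphism. -/
theorem stmt1 {k V : Type*} [Field k] [CharZero k] [AddCommGroup V] [Module k V]
    [FiniteDimensional k V] (ω : AltBilin k V)
    (hnondeg : ∀ v : V, (∀ w : V, ω.form v w = 0) → v = 0)
    (l : Submodule k V) (hLag : ∀ v : V, v ∈ l ↔ ∀ x ∈ l, ω.form v x = 0)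
    (M : Type*) [AddCommGroup M] [Module k M]
    [LieRingModule (Heisenberg ω) M] [LieModule k (Heisenberg ω) M]
    (hnil : ∀ x ∈ l, ∀ m : M,
      ∃ i : ℕ, (fun m' : M => ⁅Heisenberg.ofV ω x, m'⁆)^[i] m = 0)
    (hz : Function.Bijective fun m : M => ⁅Heisenberg.zH ω, m⁆) :
    (∀ (h : Heisenberg ω) (u : UniversalEnvelopingAlgebra k (Heisenberg ω))
        (m : ↥(invSub ω M l)),
        alphaMap ω M l ((UniversalEnvelopingAlgebra.ι k h * u) ⊗ₜ[k] m)
          = ⁅h, alphaMap ω M l (u ⊗ₜ[k] m)⁆)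
    ∧ LinearMap.ker (alphaMap ω M l) = relSub ω M l
    ∧ Function.Surjective (alphaMap ω M l) := by
  obtain ⟨x, y, hxy⟩ := exists_isLagrangianFrame ω hnondeg l hLag
  refine ⟨fun h u m => ?_, le_antisymm (fun t ht => ?_) relSub_le_ker, ?_⟩
  · rw [alphaMap_tmul, alphaMap_tmul, map_mul, Module.End.mul_apply, uAct_ι]
  · exact mem_relSub_of_alphaMap_eq_zero hxy hz ht
  · have h := isCCR_toEnd ω M
    intro m
    obtain ⟨d, hd⟩ := h.exists_mem_nilFiltration hxy (fun v hv m => by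
      obtain ⟨i, hi⟩ := hnil v hv m
      exact ⟨i, by rw [Module.End.pow_apply]; exact hi⟩) m
    refine h.nilFiltration_le hxy hz (P := LinearMap.range (alphaMap ω M l)) ?_ ?_ d hd
    · rintro v _ ⟨t, rfl⟩
      refine ⟨(LinearMap.mulLeft k (UniversalEnvelopingAlgebra.ι k (Heisenberg.ofV ω v))).rTensor
        _ t, ?_⟩
      rw [alphaMap_mul_rTensor, uAct_ι]
      rfl
    · intro n hn
      refine ⟨1 ⊗ₜ ⟨n, hn⟩, ?_⟩
      rw [alphaMap_tmul, map_one, Module.End.one_apply]
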